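/- Let a and b be distinct points of a real inner product space E (or ℝⁿ with the Euclidean norm). The distance ratio function f(x) = ‖x − a‖ / ‖x − b‖ is quasiconvex on the halfspace {x ∈ E | ‖x − a‖ ≤ ‖x − b‖}. -/

import Mathlib

/-- Stewart's identity: the squared distance from a convex combination. -/
theorem norm_sq_convexCombo_sub {E : Type*} [NormedAddCommGroup E] [InnerProductSpace ℝ E]
    (x y c : E) {p q : ℝ} (hpq : p + q = 1) :
    ‖p • x + q • y - c‖ ^ 2 = p * ‖x - c‖ ^ 2 + q * ‖y - c‖ ^ 2 - p * q * ‖x - y‖ ^ 2 := by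
  obtain rfl : q = 1 - p := by linarith
  have h₁ : p • x + (1 - p) • y - c = p • (x - c) + (1 - p) • (y - c) := by module
  have h₂ : x - y = (x - c) - (y - c) := by abel
  rw [h₁, h₂, norm_add_sq_real, norm_sub_sq_real (x - c), norm_smul, norm_smul,
    real_inner_smul_left, real_inner_smul_right, mul_pow, mul_pow, Real.norm_eq_abs,
    Real.norm_eq_abs, sq_abs, sq_abs]
  ring

/-- Apollonius balls are convex. -/
theorem convex_setOf_norm_sub_sq_le {E : Type*} [NormedAddCommGroup E] [InnerProductSpace ℝ E]
    (a b : E) {t : ℝ} (ht : t ≤ 1) :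
    Convex ℝ {x : E | ‖x - a‖ ^ 2 ≤ t * ‖x - b‖ ^ 2} := by
  intro x hx y hy p q hp hq hpq
  simp only [Set.mem_ofPred_eq] at hx hy ⊢
  rw [norm_sq_convexCombo_sub x y a hpq, norm_sq_convexCombo_sub x y b hpq]
  have h : 0 ≤ (1 - t) * (p * q * ‖x - y‖ ^ 2) := mul_nonneg (by linarith) (by positivity)
  linarith [mul_le_mul_of_nonneg_left hx hp, mul_le_mul_of_nonneg_left hy hq]

/-- The distance ratio function `x ↦ ‖x − a‖ / ‖x − b‖` is quasiconvex on the
halfspace `{x | ‖x − a‖ ≤ ‖x − b‖}`. -/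
theorem quasiconvexOn_dist_ratio {E : Type*} [NormedAddCommGroup E]
    [InnerProductSpace ℝ E] {a b : E} (hab : a ≠ b) :
    QuasiconvexOn ℝ {x : E | ‖x - a‖ ≤ ‖x - b‖}
      (fun x => ‖x - a‖ / ‖x - b‖) := by
  intro r
  have hpos : ∀ x : E, ‖x - a‖ ≤ ‖x - b‖ → 0 < ‖x - b‖ := by
    intro x hx
    by_contra! h
    have hxa : x = a := sub_eq_zero.mp (norm_le_zero_iff.mp (hx.trans h))
    have hxb : x = b := sub_eq_zero.mp (norm_le_zero_iff.mp h)
    exact hab (hxa.symm.trans hxb)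
  have hhalf : Convex ℝ {x : E | ‖x - a‖ ≤ ‖x - b‖} := by
    convert convex_setOf_norm_sub_sq_le a b le_rfl using 3 with x
    rw [one_mul, sq_le_sq₀ (norm_nonneg _) (norm_nonneg _)]
  rcases lt_or_ge r 0 with hr | hr
  · convert convex_empty (𝕜 := ℝ) (E := E)
    ext x
    simp only [Set.mem_ofPred_eq, Set.mem_empty_iff_false, iff_false, not_and, not_le]
    exact fun _ => hr.trans_le (by positivity)
  · have hball : Convex ℝ {x : E | ‖x - a‖ ^ 2 ≤ min r 1 ^ 2 * ‖x - b‖ ^ 2} :=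
      convex_setOf_norm_sub_sq_le a b
        (pow_le_one₀ (le_min hr zero_le_one) (min_le_right r 1))
    convert hhalf.inter hball using 1
    ext x
    simp only [Set.mem_ofPred_eq, Set.mem_inter_iff]
    refine and_congr_right fun hx => ?_
    have hm : 0 ≤ min r 1 := le_min hr zero_le_one
    rw [div_le_iff₀ (hpos x hx), ← mul_pow, sq_le_sq₀ (norm_nonneg _) (by positivity),
      min_mul_of_nonneg _ _ (norm_nonneg _), le_min_iff, one_mul]
    exact (and_iff_left hx).symm
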